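/- Let q be a prime power, F_q the finite field with q elements, and ω a nonzero element of F_q. The number of invertible 3×3 matrices B over F_q satisfying b_{11} + b_{22} = ω (where b_{11}, b_{22} are the (1,1) and (2,2) entries of B) equals q^8 - q^7 - q^6 + q^4; in particular this count is the same for every nonzero ω. -/

import Mathlib

section helpers
variable {F : Type*} [Field F] [Fintype F] [DecidableEq F]

theorem aux_lin1 (α β : F) (h : α ≠ 0) :
    ∑ x : F, (if α * x + β = 0 then (1 : ℤ) else 0) = 1 := by
  have : ∀ x : F, (α * x + β = 0) ↔ x = -β / α := by
    intro x
    rw [eq_div_iff h]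
    constructor
    · intro H; linear_combination H
    · intro H; linear_combination H
  simp [this]

theorem aux_lin3 (x y z : F) :
    ∑ g : F, ∑ h : F, ∑ i : F, (if g * x + h * y + i * z = 0 then (1 : ℤ) else 0)
      = (Fintype.card F : ℤ) ^ 2 +
        (if x = 0 ∧ y = 0 ∧ z = 0 then (Fintype.card F : ℤ) ^ 3 - (Fintype.card F : ℤ) ^ 2 else 0) := by
  by_cases hz : z = 0
  · by_cases hy : y = 0
    · by_cases hx : x = 0
      · simp [hx, hy, hz]; ring
      · have := aux_lin1 x 0 hx
        simp only [add_zero, mul_comm x] at this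
        simp only [hz, hy, hx, mul_zero, add_zero, Finset.sum_const, Finset.card_univ,
          false_and, if_false]
        rw [← Finset.smul_sum, ← Finset.smul_sum, this]
        simp; ring
    · have : ∀ g : F, ∑ h : F, (if g * x + h * y = 0 then (1 : ℤ) else 0) = 1 := by
        intro g
        refine Eq.trans ?_ (aux_lin1 y (g * x) hy)
        refine Finset.sum_congr rfl fun h _ => ?_
        rw [add_comm, mul_comm h y]
      simp only [hz, hy, mul_zero, add_zero, Finset.sum_const, Finset.card_univ,
          false_and, and_false, if_false]
      simp only [← Finset.smul_sum, this]
      simp; ring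
  · have : ∀ g h : F, ∑ i : F, (if g * x + h * y + i * z = 0 then (1 : ℤ) else 0) = 1 := by
      intro g h
      refine Eq.trans ?_ (aux_lin1 z (g * x + h * y) hz)
      refine Finset.sum_congr rfl fun i _ => ?_
      rw [add_comm, mul_comm i z]
    simp [this, hz]; ring

theorem aux_hyp (k : F) :
    ∑ b : F, ∑ d : F, (if k = b * d then (1 : ℤ) else 0)
      = ((Fintype.card F : ℤ) - 1) + (if k = 0 then (Fintype.card F : ℤ) else 0) := by
  have h1 : ∀ b : F, ∑ d : F, (if k = b * d then (1 : ℤ) else 0)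
      = 1 + (if b = 0 then (if k = 0 then (Fintype.card F : ℤ) else 0) - 1 else 0) := by
    intro b
    by_cases hb : b = 0
    · by_cases hk : k = 0 <;> simp [hb, hk]
    · rw [if_neg hb, add_zero]
      refine Eq.trans ?_ (aux_lin1 b (-k) hb)
      refine Finset.sum_congr rfl fun d _ => ?_
      congr 1
      rw [← sub_eq_add_neg, sub_eq_zero, eq_comm (a := k)]
  simp only [h1, Finset.sum_add_distrib, Finset.sum_ite_eq', Finset.mem_univ, if_true]
  simp; ring

theorem aux_col (a b d e : F) (h : a + e ≠ 0) :
    ∑ c : F, ∑ f : F, (if b * f - c * e = 0 ∧ c * d - a * f = 0 ∧ a * e - b * d = 0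
        then (1 : ℤ) else 0)
      = if a * e = b * d then (Fintype.card F : ℤ) else 0 := by
  by_cases hk : a * e = b * d
  · rw [if_pos hk]
    by_cases ha : a = 0
    · have he : e ≠ 0 := by simpa [ha] using h
      rw [Finset.sum_comm]
      have : ∀ f : F, ∑ c : F, (if b * f - c * e = 0 ∧ c * d - a * f = 0 ∧ a * e - b * d = 0
        then (1 : ℤ) else 0) = 1 := by
        intro f
        refine Eq.trans ?_ (aux_lin1 e (-(b * f)) he)
        refine Finset.sum_congr rfl fun c _ => ?_
        congr 1
        apply propext
        constructor
        · rintro ⟨h1, -⟩; linear_combination -h1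
        · intro h1
          refine ⟨by linear_combination -h1, ?_, by linear_combination hk⟩
          apply mul_left_cancel₀ he
          linear_combination d * h1 - f * hk
      simp [this]
    · have : ∀ c : F, ∑ f : F, (if b * f - c * e = 0 ∧ c * d - a * f = 0 ∧ a * e - b * d = 0
        then (1 : ℤ) else 0) = 1 := by
        intro c
        refine Eq.trans ?_ (aux_lin1 a (-(c * d)) ha)
        refine Finset.sum_congr rfl fun f _ => ?_
        congr 1
        apply propext
        constructor
        · rintro ⟨-, h1, -⟩; linear_combination -h1
        · intro h1
          refine ⟨?_, by linear_combination -h1, by linear_combination hk⟩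
          apply mul_left_cancel₀ ha
          linear_combination b * h1 - c * hk
      simp [this]
  · simp [hk, sub_eq_zero]

theorem aux_N (ω : F) (hω : ω ≠ 0) :
    ∑ a : F, ∑ b : F, ∑ d : F, (if a * (ω - a) = b * d then (1 : ℤ) else 0)
      = (Fintype.card F : ℤ) ^ 2 + Fintype.card F := by
  simp only [aux_hyp]
  have h : ∀ a : F, (if a * (ω - a) = 0 then (Fintype.card F : ℤ) else 0)
      = (if a = 0 then (Fintype.card F : ℤ) else 0)
        + (if a = ω then (Fintype.card F : ℤ) else 0) := by
    intro a
    by_cases ha : a = 0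
    · simp [ha, hω.symm]
    · by_cases hb : a = ω
      · simp [hb, hω]
      · simp [ha, hb, sub_eq_zero, Ne.symm hb]
  simp only [h, Finset.sum_add_distrib, Finset.sum_ite_eq', Finset.mem_univ, if_true]
  simp; ring

/-- The matrix with prescribed entries. -/
def auxMat (ω : F) (p : F × F × F × F × F × F × F × F) : Matrix (Fin 3) (Fin 3) F :=
  !![p.1, p.2.1, p.2.2.2.1; p.2.2.1, ω - p.1, p.2.2.2.2.1;
    p.2.2.2.2.2.1, p.2.2.2.2.2.2.1, p.2.2.2.2.2.2.2]

noncomputable def auxEquiv (ω : F) :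
    {B : GL (Fin 3) F //
        (B : Matrix (Fin 3) (Fin 3) F) 0 0 + (B : Matrix (Fin 3) (Fin 3) F) 1 1 = ω} ≃
      {p : F × F × F × F × F × F × F × F // ¬ (auxMat ω p).det = 0} where
  toFun B := ⟨(B.1 0 0, B.1 0 1, B.1 1 0, B.1 0 2, B.1 1 2, B.1 2 0, B.1 2 1, B.1 2 2), by
    have h : auxMat ω (B.1 0 0, B.1 0 1, B.1 1 0, B.1 0 2, B.1 1 2, B.1 2 0, B.1 2 1, B.1 2 2)
        = (B.1 : Matrix (Fin 3) (Fin 3) F) := by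
      have := B.2
      ext i j
      fin_cases i <;> fin_cases j <;> simp [auxMat]
      linear_combination -this
    rw [h]
    exact ((Matrix.isUnit_iff_isUnit_det _).1 B.1.isUnit).ne_zero⟩
  invFun p := ⟨Matrix.GeneralLinearGroup.mkOfDetNeZero (auxMat ω p.1) p.2, by
    simp [Matrix.GeneralLinearGroup.mkOfDetNeZero, auxMat]⟩
  left_inv B := by
    apply Subtype.ext
    apply Units.ext
    have := B.2
    ext i j
    fin_cases i <;> fin_cases j <;> simp [auxMat, Matrix.GeneralLinearGroup.mkOfDetNeZero]
    linear_combination -this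
  right_inv p := by
    apply Subtype.ext
    simp [auxMat, Matrix.GeneralLinearGroup.mkOfDetNeZero]

theorem aux_sing (ω : F) (hω : ω ≠ 0) :
    ∑ p : F × F × F × F × F × F × F × F, (if (auxMat ω p).det = 0 then (1 : ℤ) else 0)
      = (Fintype.card F : ℤ) ^ 7 + (Fintype.card F : ℤ) ^ 6 - (Fintype.card F : ℤ) ^ 4 := by
  simp only [Fintype.sum_prod_type]
  have hdet : ∀ a b d c f g h i : F, (auxMat ω (a, b, d, c, f, g, h, i)).det
      = g * (b * f - c * (ω - a)) + h * (c * d - a * f) + i * (a * (ω - a) - b * d) := by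
    intros
    simp [auxMat, Matrix.det_fin_three]
    ring
  have hcol : ∀ a b d : F, ∑ c : F, ∑ f : F,
      (if b * f - c * (ω - a) = 0 ∧ c * d - a * f = 0 ∧ a * (ω - a) - b * d = 0
        then (Fintype.card F : ℤ) ^ 3 - (Fintype.card F : ℤ) ^ 2 else 0)
      = ((Fintype.card F : ℤ) ^ 3 - (Fintype.card F : ℤ) ^ 2) * (Fintype.card F : ℤ) *
        (if a * (ω - a) = b * d then 1 else 0) := by
    intro a b d
    have := aux_col a b d (ω - a) (by simpa using hω)
    rw [mul_assoc, mul_ite, mul_one, mul_zero, ← this, Finset.mul_sum]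
    simp only [Finset.mul_sum, mul_ite, mul_one, mul_zero]
  simp only [hdet, aux_lin3, Finset.sum_add_distrib, hcol, ← Finset.mul_sum, aux_N ω hω]
  simp; ring

end helpers



/-- For any nonzero `ω ∈ F_q`, the number of invertible 3×3 matrices over `F_q` with
`b₁₁ + b₂₂ = ω` is `q^8 - q^7 - q^6 + q^4`; in particular the count is the same for every
nonzero `ω`. -/
theorem card_GL3_diagSum_nonzero (q : ℕ) (F : Type*) [Field F] [Fintype F] [DecidableEq F]
    (hq : Fintype.card F = q) (ω : F) (hω : ω ≠ 0) :
    (Nat.card {B : GL (Fin 3) F //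
        (B : Matrix (Fin 3) (Fin 3) F) 0 0 + (B : Matrix (Fin 3) (Fin 3) F) 1 1 = ω} : ℤ) =
      (q : ℤ) ^ 8 - q ^ 7 - q ^ 6 + q ^ 4 := by

  subst hq
  have h := aux_sing ω hω
  rw [Nat.card_congr (auxEquiv ω), Nat.card_eq_fintype_card, Fintype.card_subtype_compl,
    Nat.cast_sub (Fintype.card_subtype_le _), Fintype.card_subtype]
  rw [Finset.sum_boole] at h
  rw [h]
  simp only [Fintype.card_prod]
  push_cast
  ring
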